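/- arXiv:2406.12988 — 3 statements merged into one kernel-verified Lean document; each statement's English description precedes it below -/
import Mathlib

section
/- Let p₁ ≥ 2, p₂ ≥ 2 and p₃ > 0 be real numbers with p₂ > p₃ + 1. For every Schwartz function u : ℝ² → ℂ, ∫_{ℝ²} |u|^{p₁+p₂} dxdy ≤ (p₁ p₂ / √(2p₃+1)) · (∫_{ℝ²} |u|^{2(p₂−p₃−1)} dxdy)^{1/2} · (∫_{ℝ²} |u|^{2(2p₃+1)} dxdy)^{1/4} · (∫_{ℝ²} |u|^{2(p₁−1)} dxdy)^{1/2} · (∫_{ℝ²} |∂_x u|² dxdy)^{1/2} · (∫_{ℝ²} |∂_yy u|² dxdy)^{1/4}. -/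
open MeasureTheory

noncomputable section

/-- Partial derivative in the first (x) variable. -/
def pdx (u : ℝ × ℝ → ℂ) : ℝ × ℝ → ℂ := fun z => deriv (fun x => u (x, z.2)) z.1

/-- Partial derivative in the second (y) variable. -/
def pdy (u : ℝ × ℝ → ℂ) : ℝ × ℝ → ℂ := fun z => deriv (fun y => u (z.1, y)) z.2

/-- Second partial derivative in x. -/
def pdxx (u : ℝ × ℝ → ℂ) : ℝ × ℝ → ℂ := pdx (pdx u)

/-- Second partial derivative in y. -/
def pdyy (u : ℝ × ℝ → ℂ) : ℝ × ℝ → ℂ := pdy (pdy u)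

/-- Fourth partial derivative in y. -/
def pdyyyy (u : ℝ × ℝ → ℂ) : ℝ × ℝ → ℂ := pdy (pdy (pdy (pdy u)))

/-- X(u) = ∫ |∂ₓ u|². -/
def Xf (u : ℝ × ℝ → ℂ) : ℝ := ∫ z : ℝ × ℝ, ‖pdx u z‖ ^ 2

/-- Y(u) = ∫ |∂_yy u|². -/
def Yf (u : ℝ × ℝ → ℂ) : ℝ := ∫ z : ℝ × ℝ, ‖pdyy u z‖ ^ 2

/-- M(u) = ∫ |u|². -/
def Mf (u : ℝ × ℝ → ℂ) : ℝ := ∫ z : ℝ × ℝ, ‖u z‖ ^ 2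

/-- P(u) = ∫ |u|ᵖ. -/
def Pf (p : ℝ) (u : ℝ × ℝ → ℂ) : ℝ := ∫ z : ℝ × ℝ, ‖u z‖ ^ p

/-- Energy E(u) = X(u)/2 + Y(u)/2 − P(u)/p. -/
def Ef (p : ℝ) (u : ℝ × ℝ → ℂ) : ℝ := Xf u / 2 + Yf u / 2 - Pf p u / p

/-- Action J_ω(u) = X(u)/2 + Y(u)/2 + (ω/2) M(u) − P(u)/p. -/
def Jf (p ω : ℝ) (u : ℝ × ℝ → ℂ) : ℝ := Xf u / 2 + Yf u / 2 + ω / 2 * Mf u - Pf p u / p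

/-- Standing wave equation −∂ₓₓu + ∂_yyyy u + ω u = |u|^{p−2} u pointwise. -/
def IsStandingWave (p ω : ℝ) (u : ℝ × ℝ → ℂ) : Prop :=
  ∀ z : ℝ × ℝ, -pdxx u z + pdyyyy u z + (ω : ℂ) * u z = ((‖u z‖ ^ (p - 2) : ℝ) : ℂ) * u z

/-- Mass-preserving anisotropic scaling u_λ(x,y) = λ^{3/8} u(λ^{1/2} x, λ^{1/4} y). -/
def uscale (l : ℝ) (u : ℝ × ℝ → ℂ) : ℝ × ℝ → ℂ :=
  fun z => ((l ^ ((3 : ℝ) / 8) : ℝ) : ℂ) * u (l ^ ((1 : ℝ) / 2) * z.1, l ^ ((1 : ℝ) / 4) * z.2)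

end

/-! ### One-dimensional estimates -/

theorem le_integral_abs_of_hasDerivAt {f f' : ℝ → ℝ} (h : ∀ x, HasDerivAt f (f' x) x)
    (hf' : Integrable f') (hf : Integrable f) (x : ℝ) : f x ≤ ∫ t, |f' t| := by
  have ht := tendsto_zero_of_hasDerivAt_of_integrableOn_Iic (a := x) (fun t _ => h t)
    hf'.integrableOn hf.integrableOn
  have he := integral_Iic_of_hasDerivAt_of_tendsto' (a := x) (fun t _ => h t) hf'.integrableOn ht
  rw [sub_zero] at he
  rw [← he]
  calc ∫ t in Set.Iic x, f' t ≤ ∫ t in Set.Iic x, |f' t| :=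
        integral_mono hf'.integrableOn hf'.abs.integrableOn fun t => le_abs_self _
    _ ≤ ∫ t, |f' t| :=
        setIntegral_le_integral hf'.abs (Filter.Eventually.of_forall fun t => abs_nonneg _)

theorem hasDerivAt_mul_of_continuousAt_of_eq_zero {φ h : ℝ → ℝ} {h' y : ℝ}
    (hφ : ContinuousAt φ y) (hh : HasDerivAt h h' y) (h0 : h y = 0) :
    HasDerivAt (fun t => φ t * h t) (φ y * h') y := by
  rw [hasDerivAt_iff_tendsto_slope] at hh ⊢
  refine ((hφ.tendsto.mono_left nhdsWithin_le_nhds).mul hh).congr fun t => ?_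
  simp only [slope_def_field, h0]
  ring

/-! ### Derivatives of powers of the norm -/

section InnerProduct

variable {E : Type*} [NormedAddCommGroup E] [InnerProductSpace ℝ E]

theorem norm_rpow_mul_abs_inner_le (q : ℝ) (a b : E) :
    ‖a‖ ^ q * |inner ℝ a b| ≤ ‖a‖ ^ (q + 1) * ‖b‖ := by
  rcases eq_or_ne a 0 with rfl | ha
  · simp only [inner_zero_left, abs_zero, mul_zero]
    positivity
  · rw [Real.rpow_add_one (norm_ne_zero_iff.2 ha), mul_assoc]
    gcongr
    exact abs_real_inner_le_norm a b

theorem norm_rpow_sub_two_mul_inner_sq_le (q : ℝ) (a b : E) :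
    ‖a‖ ^ (q - 2) * inner ℝ a b ^ 2 ≤ ‖a‖ ^ q * ‖b‖ ^ 2 := by
  have h1 := norm_rpow_mul_abs_inner_le (q - 2) a b
  have h2 := norm_rpow_mul_abs_inner_le (q - 1) a b
  calc ‖a‖ ^ (q - 2) * inner ℝ a b ^ 2
      = (‖a‖ ^ (q - 2) * |inner ℝ a b|) * |inner ℝ a b| := by
        rw [← sq_abs]; ring
    _ ≤ (‖a‖ ^ (q - 2 + 1) * ‖b‖) * |inner ℝ a b| := by gcongr
    _ = (‖a‖ ^ (q - 1) * |inner ℝ a b|) * ‖b‖ := by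
        rw [show q - 2 + 1 = q - 1 by ring]; ring
    _ ≤ (‖a‖ ^ (q - 1 + 1) * ‖b‖) * ‖b‖ := by gcongr
    _ = ‖a‖ ^ q * ‖b‖ ^ 2 := by rw [sub_add_cancel]; ring

theorem hasDerivAt_norm_rpow_of_one_lt {f : ℝ → E} {f' : E} {y p : ℝ} (hf : HasDerivAt f f' y)
    (hp : 1 < p) :
    HasDerivAt (fun t => ‖f t‖ ^ p) (p * (‖f y‖ ^ (p - 2) * inner ℝ (f y) f')) y := by
  have h := (hasFDerivAt_norm_rpow (f y) hp).comp_hasDerivAt y hf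
  convert! h using 1
  simp [mul_assoc]

theorem hasDerivAt_norm_rpow_mul_inner {f g : ℝ → E} {g' : E} {y q : ℝ} (hq : 0 < q)
    (hf : HasDerivAt f (g y) y) (hg : HasDerivAt g g' y) :
    HasDerivAt (fun t => ‖f t‖ ^ q * inner ℝ (f t) (g t))
      (‖f y‖ ^ q * ‖g y‖ ^ 2 + q * (‖f y‖ ^ (q - 2) * inner ℝ (f y) (g y) ^ 2)
        + ‖f y‖ ^ q * inner ℝ (f y) g') y := by
  have hi := hf.inner ℝ hg
  rcases eq_or_ne (f y) 0 with h0 | h0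
  · have hc : ContinuousAt (fun t => ‖f t‖ ^ q) y :=
      hf.continuousAt.norm.rpow_const (Or.inr hq.le)
    convert! hasDerivAt_mul_of_continuousAt_of_eq_zero hc hi (by simp [h0]) using 1
    simp [h0, Real.zero_rpow hq.ne']
  · have hn : HasDerivAt (fun t => ‖f t‖ ^ q)
        (q * (‖f y‖ ^ (q - 2) * inner ℝ (f y) (g y))) y := by
      have h2 := (hf.norm_sq).rpow_const (p := q / 2) (Or.inl (by positivity))
      have e : ∀ t r : ℝ, (‖f t‖ ^ 2) ^ r = ‖f t‖ ^ (2 * r) := fun t r => by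
        rw [← Real.rpow_natCast, ← Real.rpow_mul (norm_nonneg _)]; norm_num
      simp only [e] at h2
      convert! h2 using 1
      · funext t; congr 1; ring
      · rw [show 2 * (q / 2 - 1) = q - 2 by ring]; ring
    convert! hn.mul hi using 1
    rw [real_inner_self_eq_norm_sq]
    ring

end InnerProduct

/-! ### Integrals over the plane -/

theorem integral_mul_le_mul_integral_abs_deriv {F G F' G' : ℝ × ℝ → ℝ}
    (hF0 : ∀ z, 0 ≤ F z) (hG0 : ∀ z, 0 ≤ G z)
    (hF : Integrable F) (hF' : Integrable F') (hG : Integrable G) (hG' : Integrable G')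
    (hdF : ∀ z, HasDerivAt (fun x => F (x, z.2)) (F' z) z.1)
    (hdG : ∀ z, HasDerivAt (fun y => G (z.1, y)) (G' z) z.2) :
    ∫ z, F z * G z ≤ (∫ z, |F' z|) * ∫ z, |G' z| := by
  have hA : ∀ᵐ y : ℝ, ∀ x, F (x, y) ≤ ∫ t, |F' (t, y)| := by
    filter_upwards [hF.prod_left_ae, hF'.prod_left_ae] with y h h' x
    exact le_integral_abs_of_hasDerivAt (fun t => hdF (t, y)) h' h x
  have hB : ∀ᵐ x : ℝ, ∀ y, G (x, y) ≤ ∫ t, |G' (x, t)| := by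
    filter_upwards [hG.prod_right_ae, hG'.prod_right_ae] with x h h' y
    exact le_integral_abs_of_hasDerivAt (fun t => hdG (x, t)) h' h y
  have iA : Integrable fun y : ℝ => ∫ t, |F' (t, y)| := hF'.abs.integral_prod_right
  have iB : Integrable fun x : ℝ => ∫ t, |G' (x, t)| := hG'.abs.integral_prod_left
  calc ∫ z, F z * G z
      ≤ ∫ z : ℝ × ℝ, (∫ t, |G' (z.1, t)|) * ∫ t, |F' (t, z.2)| := by
        refine integral_mono_of_nonneg
          (Filter.Eventually.of_forall fun z => mul_nonneg (hF0 z) (hG0 z)) (iB.mul_prod iA) ?_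
        filter_upwards [Measure.quasiMeasurePreserving_fst.ae hB,
          Measure.quasiMeasurePreserving_snd.ae hA] with z h1 h2
        rw [mul_comm]
        exact mul_le_mul (h1 z.2) (h2 z.1) (hF0 z) (integral_nonneg fun t => abs_nonneg _)
    _ = (∫ x, ∫ t, |G' (x, t)|) * ∫ y, ∫ t, |F' (t, y)| :=
        integral_prod_mul (fun x : ℝ => ∫ t, |G' (x, t)|) fun y : ℝ => ∫ t, |F' (t, y)|
    _ = (∫ z, |F' z|) * ∫ z, |G' z| := by
        rw [mul_comm]
        congr 1
        · exact (integral_prod_symm _ hF'.abs).symm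
        · exact (integral_prod _ hG'.abs).symm

theorem integral_eq_zero_of_hasDerivAt_snd {G G' : ℝ × ℝ → ℝ}
    (hG : Integrable G) (hG' : Integrable G')
    (hd : ∀ z, HasDerivAt (fun y => G (z.1, y)) (G' z) z.2) : ∫ z, G' z = 0 := by
  have h : ∀ᵐ x : ℝ, ∫ y, G' (x, y) = 0 := by
    filter_upwards [hG.prod_right_ae, hG'.prod_right_ae] with x h h'
    exact integral_eq_zero_of_hasDerivAt_of_integrable (fun t => hd (x, t)) h' h
  exact (integral_prod _ hG').trans (integral_eq_zero_of_ae h)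

theorem integral_mul_le_rpow_half {α : Type*} [MeasurableSpace α] {μ : Measure α} {f g : α → ℝ}
    (hf0 : ∀ z, 0 ≤ f z) (hg0 : ∀ z, 0 ≤ g z) (hf : MemLp f 2 μ) (hg : MemLp g 2 μ) :
    ∫ z, f z * g z ∂μ
      ≤ (∫ z, f z ^ 2 ∂μ) ^ ((1 : ℝ) / 2) * (∫ z, g z ^ 2 ∂μ) ^ ((1 : ℝ) / 2) := by
  have h := integral_mul_le_Lp_mul_Lq_of_nonneg Real.HolderConjugate.two_two (μ := μ)
    (Filter.Eventually.of_forall hf0) (Filter.Eventually.of_forall hg0)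
    (by simpa using hf) (by simpa using hg)
  simpa only [Real.rpow_two] using h

theorem norm_rpow_sq {E : Type*} [SeminormedAddCommGroup E] (a : E) (q : ℝ) :
    (‖a‖ ^ q) ^ 2 = ‖a‖ ^ (2 * q) := by
  rw [← Real.rpow_mul_natCast (norm_nonneg _), mul_comm]
  norm_num

/-! ### Schwartz functions on the plane -/

namespace SchwartzMap

open LineDeriv

variable (f g : SchwartzMap (ℝ × ℝ) ℂ)

theorem integrable_norm_rpow {q : ℝ} (hq : 0 < q) : Integrable fun z => ‖f z‖ ^ q := by
  have h := (f.memLp (ENNReal.ofReal q)).integrable_norm_rpow (by simpa using hq)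
    ENNReal.ofReal_ne_top
  simpa only [ENNReal.toReal_ofReal hq.le] using h

theorem memLp_two_norm_rpow {q : ℝ} (hq : 0 < q) : MemLp (fun z => ‖f z‖ ^ q) 2 := by
  have hm : Measurable fun z => ‖f z‖ ^ q := f.continuous.measurable.norm.pow_const q
  rw [memLp_two_iff_integrable_sq hm.aestronglyMeasurable]
  simpa only [norm_rpow_sq] using f.integrable_norm_rpow (q := 2 * q) (by positivity)

theorem memLp_two_norm : MemLp (fun z => ‖f z‖) 2 := (f.memLp 2).norm

theorem integrable_norm_rpow_mul_norm {q : ℝ} (hq : 0 < q) :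
    Integrable fun z => ‖f z‖ ^ q * ‖g z‖ :=
  (f.memLp_two_norm_rpow hq).integrable_mul g.memLp_two_norm

theorem integrable_norm_rpow_mul_norm_sq {q : ℝ} (hq : 0 < q) :
    Integrable fun z => ‖f z‖ ^ q * ‖g z‖ ^ 2 := by
  have h := (f.memLp_two_norm_rpow hq).integrable_mul (g.memLp_two_norm_rpow two_pos)
  simp only [Real.rpow_two] at h
  exact h

theorem integrable_norm_rpow_mul_inner {q : ℝ} (hq : -1 < q) :
    Integrable fun z => ‖f z‖ ^ q * inner ℝ (f z) (g z) := by
  have hm : Measurable fun z => ‖f z‖ ^ q * inner ℝ (f z) (g z) :=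
    (f.continuous.measurable.norm.pow_const q).mul (f.continuous.inner g.continuous).measurable
  refine (f.integrable_norm_rpow_mul_norm g (q := q + 1) (by linarith)).mono'
    hm.aestronglyMeasurable (Filter.Eventually.of_forall fun z => ?_)
  rw [Real.norm_eq_abs, abs_mul, abs_of_nonneg (Real.rpow_nonneg (norm_nonneg _) _)]
  exact norm_rpow_mul_abs_inner_le q _ _

theorem integrable_norm_rpow_sub_two_mul_inner_sq {q : ℝ} (hq : 0 < q) :
    Integrable fun z => ‖f z‖ ^ (q - 2) * inner ℝ (f z) (g z) ^ 2 := by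
  have hm : Measurable fun z => ‖f z‖ ^ (q - 2) * inner ℝ (f z) (g z) ^ 2 :=
    (f.continuous.measurable.norm.pow_const _).mul
      ((f.continuous.inner g.continuous).measurable.pow_const 2)
  refine (f.integrable_norm_rpow_mul_norm_sq g hq).mono'
    hm.aestronglyMeasurable (Filter.Eventually.of_forall fun z => ?_)
  rw [Real.norm_eq_abs, abs_of_nonneg (by positivity)]
  exact norm_rpow_sub_two_mul_inner_sq_le q _ _

theorem hasDerivAt_fst (z : ℝ × ℝ) :
    HasDerivAt (fun x => f (x, z.2)) ((∂_{((1 : ℝ), (0 : ℝ))} f) z) z.1 := by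
  rw [lineDerivOp_apply_eq_fderiv]
  exact f.differentiableAt.hasFDerivAt.comp_hasDerivAt z.1
    ((hasDerivAt_id z.1).prodMk (hasDerivAt_const z.1 z.2))

theorem hasDerivAt_snd (z : ℝ × ℝ) :
    HasDerivAt (fun y => f (z.1, y)) ((∂_{((0 : ℝ), (1 : ℝ))} f) z) z.2 := by
  rw [lineDerivOp_apply_eq_fderiv]
  exact f.differentiableAt.hasFDerivAt.comp_hasDerivAt z.2
    ((hasDerivAt_const z.2 z.1).prodMk (hasDerivAt_id z.2))

theorem pdx_eq : pdx (fun z => f z) = ∂_{((1 : ℝ), (0 : ℝ))} f :=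
  funext fun z => (f.hasDerivAt_fst z).deriv

theorem pdy_eq : pdy (fun z => f z) = ∂_{((0 : ℝ), (1 : ℝ))} f :=
  funext fun z => (f.hasDerivAt_snd z).deriv

theorem pdyy_eq : pdyy (fun z => f z) = ∂_{((0 : ℝ), (1 : ℝ))} (∂_{((0 : ℝ), (1 : ℝ))} f) := by
  rw [pdyy, pdy_eq]
  exact pdy_eq _

/-- Integration by parts in `y`: the factor `q + 1` comes from the derivative of `|f|`. -/
theorem integral_norm_rpow_mul_inner_sq_le {q : ℝ} (hq : 0 < q) :
    (q + 1) * ∫ z, ‖f z‖ ^ (q - 2) * inner ℝ (f z) ((∂_{((0 : ℝ), (1 : ℝ))} f) z) ^ 2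
      ≤ ∫ z, ‖f z‖ ^ (q + 1) * ‖(∂_{((0 : ℝ), (1 : ℝ))} (∂_{((0 : ℝ), (1 : ℝ))} f)) z‖ := by
  set g := ∂_{((0 : ℝ), (1 : ℝ))} f with hg
  set h := ∂_{((0 : ℝ), (1 : ℝ))} g with hh
  have iS := f.integrable_norm_rpow_sub_two_mul_inner_sq g hq
  have iT := f.integrable_norm_rpow_mul_norm_sq g hq
  have iH := f.integrable_norm_rpow_mul_inner h (q := q) (by linarith)
  have iW := f.integrable_norm_rpow_mul_norm h (q := q + 1) (by linarith)
  have iD := (iT.add (iS.const_mul q)).add iH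
  have h0 := integral_eq_zero_of_hasDerivAt_snd
    (f.integrable_norm_rpow_mul_inner g (q := q) (by linarith)) iD
    fun z => hasDerivAt_norm_rpow_mul_inner hq (f.hasDerivAt_snd z) (g.hasDerivAt_snd z)
  rw [← integral_const_mul, ← zero_add (∫ z, ‖f z‖ ^ (q + 1) * ‖h z‖), ← h0,
    ← integral_add iD iW]
  refine integral_mono (iS.const_mul _) (iD.add iW) fun z => ?_
  have h1 := norm_rpow_sub_two_mul_inner_sq_le q (f z) (g z)
  have h2 := norm_rpow_mul_abs_inner_le q (f z) (h z)
  have h3 : -(‖f z‖ ^ q * inner ℝ (f z) (h z)) ≤ ‖f z‖ ^ q * |inner ℝ (f z) (h z)| := by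
    rw [← mul_neg]
    gcongr
    exact neg_le_abs _
  simp only [Pi.add_apply]
  linarith

theorem integral_norm_rpow_mul_abs_inner_fst_le {p : ℝ} (hp : 1 < p) :
    ∫ z, ‖f z‖ ^ (p - 2) * |inner ℝ (f z) (g z)|
      ≤ (∫ z, ‖f z‖ ^ (2 * (p - 1))) ^ ((1 : ℝ) / 2) * (∫ z, ‖g z‖ ^ 2) ^ ((1 : ℝ) / 2) := by
  have hp' : 0 < p - 1 := by linarith
  have h := integral_mul_le_rpow_half (fun z => by positivity) (fun z => norm_nonneg (g z))
    (f.memLp_two_norm_rpow hp') g.memLp_two_norm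
  simp only [norm_rpow_sq] at h
  refine le_trans (integral_mono_of_nonneg (Filter.Eventually.of_forall fun z => by positivity)
    (f.integrable_norm_rpow_mul_norm g hp') (Filter.Eventually.of_forall fun z => ?_)) h
  have := norm_rpow_mul_abs_inner_le (p - 2) (f z) (g z)
  rwa [show p - 2 + 1 = p - 1 by ring] at this

theorem integral_norm_rpow_mul_abs_inner_snd_le {p r : ℝ} (hr : 0 < r) (hrp : r + 1 < p) :
    ∫ z, ‖f z‖ ^ (p - 2) * |inner ℝ (f z) (g z)|
      ≤ (∫ z, ‖f z‖ ^ (2 * (p - r - 1))) ^ ((1 : ℝ) / 2)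
        * (∫ z, ‖f z‖ ^ (2 * r - 2) * inner ℝ (f z) (g z) ^ 2) ^ ((1 : ℝ) / 2) := by
  have e : ∀ z, (‖f z‖ ^ (r - 1) * |inner ℝ (f z) (g z)|) ^ 2
      = ‖f z‖ ^ (2 * r - 2) * inner ℝ (f z) (g z) ^ 2 := fun z => by
    rw [mul_pow, norm_rpow_sq, sq_abs, mul_sub, mul_one]
  have hm : Measurable fun z => ‖f z‖ ^ (r - 1) * |inner ℝ (f z) (g z)| :=
    (f.continuous.measurable.norm.pow_const _).mul
      (f.continuous.inner g.continuous).abs.measurable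
  have hL : MemLp (fun z => ‖f z‖ ^ (r - 1) * |inner ℝ (f z) (g z)|) 2 := by
    rw [memLp_two_iff_integrable_sq hm.aestronglyMeasurable]
    simpa only [e] using f.integrable_norm_rpow_sub_two_mul_inner_sq g (q := 2 * r) (by linarith)
  have h := integral_mul_le_rpow_half (fun z => by positivity) (fun z => by positivity)
    (f.memLp_two_norm_rpow (q := p - r - 1) (by linarith)) hL
  simp only [norm_rpow_sq, e] at h
  refine le_of_eq_of_le (integral_congr_ae (Filter.Eventually.of_forall fun z => ?_)) h
  rcases eq_or_ne (f z) 0 with h0 | h0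
  · simp [h0]
  · simp only
    rw [← mul_assoc, ← Real.rpow_add (norm_pos_iff.2 h0)]
    congr 2
    ring

end SchwartzMap

/-- Two-dimensional anisotropic interpolation inequality. -/
theorem stmt_3 (p₁ p₂ p₃ : ℝ) (h1 : 2 ≤ p₁) (h2 : 2 ≤ p₂) (h3 : 0 < p₃) (h4 : p₃ + 1 < p₂)
    (u : SchwartzMap (ℝ × ℝ) ℂ) :
    (∫ z : ℝ × ℝ, ‖u z‖ ^ (p₁ + p₂)) ≤
      (p₁ * p₂ / Real.sqrt (2 * p₃ + 1))
        * (∫ z : ℝ × ℝ, ‖u z‖ ^ (2 * (p₂ - p₃ - 1))) ^ ((1 : ℝ) / 2)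
        * (∫ z : ℝ × ℝ, ‖u z‖ ^ (2 * (2 * p₃ + 1))) ^ ((1 : ℝ) / 4)
        * (∫ z : ℝ × ℝ, ‖u z‖ ^ (2 * (p₁ - 1))) ^ ((1 : ℝ) / 2)
        * Xf (fun z => u z) ^ ((1 : ℝ) / 2) * Yf (fun z => u z) ^ ((1 : ℝ) / 4) := by
  have hv := u.pdx_eq
  have hw := u.pdyy_eq
  simp only [Xf, Yf]
  rw [hv, hw]
  set v := LineDeriv.lineDerivOp ((1 : ℝ), (0 : ℝ)) u
  set g := LineDeriv.lineDerivOp ((0 : ℝ), (1 : ℝ)) u with hg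
  set w := LineDeriv.lineDerivOp ((0 : ℝ), (1 : ℝ)) g with hw
  have hmain := integral_mul_le_mul_integral_abs_deriv
    (fun z => by positivity) (fun z => by positivity)
    (u.integrable_norm_rpow (q := p₁) (by linarith))
    ((u.integrable_norm_rpow_mul_inner v (q := p₁ - 2) (by linarith)).const_mul p₁)
    (u.integrable_norm_rpow (q := p₂) (by linarith))
    ((u.integrable_norm_rpow_mul_inner g (q := p₂ - 2) (by linarith)).const_mul p₂)
    (fun z => hasDerivAt_norm_rpow_of_one_lt (u.hasDerivAt_fst z) (by linarith))
    (fun z => hasDerivAt_norm_rpow_of_one_lt (u.hasDerivAt_snd z) (by linarith))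
  have e1 : ∀ z, ‖u z‖ ^ p₁ * ‖u z‖ ^ p₂ = ‖u z‖ ^ (p₁ + p₂) := fun z =>
    (Real.rpow_add_of_nonneg (norm_nonneg _) (by linarith) (by linarith)).symm
  have e2 : ∀ (p : ℝ), 2 ≤ p → ∀ a b : ℂ, |p * (‖a‖ ^ (p - 2) * inner ℝ a b)|
      = p * (‖a‖ ^ (p - 2) * |inner ℝ a b|) := fun p hp a b => by
    rw [abs_mul, abs_mul, abs_of_nonneg (by linarith : 0 ≤ p), abs_of_nonneg (by positivity)]
  simp only [e1, e2 p₁ h1, e2 p₂ h2, integral_const_mul] at hmain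
  have hx := u.integral_norm_rpow_mul_abs_inner_fst_le v (p := p₁) (by linarith)
  have hy := u.integral_norm_rpow_mul_abs_inner_snd_le g h3 h4
  have hS := u.integral_norm_rpow_mul_inner_sq_le (q := 2 * p₃) (by linarith)
  have hCS := integral_mul_le_rpow_half (fun z => by positivity) (fun z => norm_nonneg (w z))
    (u.memLp_two_norm_rpow (q := 2 * p₃ + 1) (by linarith)) w.memLp_two_norm
  simp only [norm_rpow_sq] at hCS
  rw [← hg, ← hw] at hS
  have hA0 : 0 ≤ ∫ z, ‖u z‖ ^ (2 * (p₂ - p₃ - 1)) := integral_nonneg fun z => by positivity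
  have hB0 : 0 ≤ ∫ z, ‖u z‖ ^ (2 * (2 * p₃ + 1)) := integral_nonneg fun z => by positivity
  have hC0 : 0 ≤ ∫ z, ‖u z‖ ^ (2 * (p₁ - 1)) := integral_nonneg fun z => by positivity
  have hX0 : 0 ≤ ∫ z, ‖v z‖ ^ 2 := integral_nonneg fun z => by positivity
  have hY0 : 0 ≤ ∫ z, ‖w z‖ ^ 2 := integral_nonneg fun z => by positivity
  have hS0 : 0 ≤ ∫ z, ‖u z‖ ^ (2 * p₃ - 2) * inner ℝ (u z) (g z) ^ 2 :=
    integral_nonneg fun z => by positivity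
  have hJ0 : 0 ≤ ∫ z, ‖u z‖ ^ (p₂ - 2) * |inner ℝ (u z) (g z)| :=
    integral_nonneg fun z => by positivity
  generalize (∫ z, ‖u z‖ ^ (2 * (p₂ - p₃ - 1))) = A at *
  generalize (∫ z, ‖u z‖ ^ (2 * (2 * p₃ + 1))) = B at *
  generalize (∫ z, ‖u z‖ ^ (2 * (p₁ - 1))) = C at *
  generalize (∫ z, ‖v z‖ ^ 2) = X at *
  generalize (∫ z, ‖w z‖ ^ 2) = Y at *
  generalize (∫ z, ‖u z‖ ^ (2 * p₃ - 2) * inner ℝ (u z) (g z) ^ 2) = S at *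
  generalize (∫ z, ‖u z‖ ^ (p₂ - 2) * |inner ℝ (u z) (g z)|) = J at *
  generalize (∫ z, ‖u z‖ ^ (p₁ - 2) * |inner ℝ (u z) (v z)|) = I at *
  have hk : 0 < 2 * p₃ + 1 := by linarith
  have hroot : S ^ ((1 : ℝ) / 2)
      ≤ B ^ ((1 : ℝ) / 4) * Y ^ ((1 : ℝ) / 4) / Real.sqrt (2 * p₃ + 1) := by
    have h : S ≤ B ^ ((1 : ℝ) / 2) * Y ^ ((1 : ℝ) / 2) / (2 * p₃ + 1) := by
      rw [le_div_iff₀ hk, mul_comm]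
      exact hS.trans hCS
    refine (Real.rpow_le_rpow hS0 h (by norm_num)).trans_eq ?_
    rw [Real.div_rpow (by positivity) hk.le, Real.mul_rpow (by positivity) (by positivity),
      ← Real.rpow_mul hB0, ← Real.rpow_mul hY0, Real.sqrt_eq_rpow]
    norm_num
  have hp1 : 0 ≤ p₁ := by linarith
  have hp2 : 0 ≤ p₂ := by linarith
  calc _ ≤ p₁ * I * (p₂ * J) := hmain
    _ ≤ p₁ * (C ^ ((1 : ℝ) / 2) * X ^ ((1 : ℝ) / 2)) * (p₂ * (A ^ ((1 : ℝ) / 2) *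
        (B ^ ((1 : ℝ) / 4) * Y ^ ((1 : ℝ) / 4) / Real.sqrt (2 * p₃ + 1)))) := by
        gcongr
        exact hy.trans (by gcongr)
    _ = _ := by ring
end

section
/- Let p > 2 and ω ∈ ℝ. If u is a standing-wave solution, then the Pohozaev identity X(u) + Y(u) = (3(p−2)/(4p)) · P(u) holds. -/
open MeasureTheory

open scoped SchwartzMap LineDeriv

theorem inner_norm_rpow_smul_self {F : Type*} [NormedAddCommGroup F] [InnerProductSpace ℝ F]
    {p : ℝ} (hp : p ≠ 0) (a b : F) (hb : b = ‖a‖ ^ (p - 2) • a) : inner ℝ b a = ‖a‖ ^ p := by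
  rw [hb, real_inner_smul_left, real_inner_self_eq_norm_sq]
  rcases eq_or_ne a 0 with rfl | h
  · simp [Real.zero_rpow hp]
  · rw [← Real.rpow_natCast, ← Real.rpow_add (norm_pos_iff.2 h)]
    norm_num

namespace SchwartzMap

variable {E F : Type*} [NormedAddCommGroup E] [NormedSpace ℝ E]
  [NormedAddCommGroup F] [InnerProductSpace ℝ F]

theorem lineDerivOp_comm (v w : E) (f : 𝓢(E, F)) : ∂_{v} (∂_{w} f) = ∂_{w} (∂_{v} f) := by
  have key (a b : E) (x : E) : ∂_{a} (∂_{b} f) x = fderiv ℝ (fderiv ℝ f) x a b := by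
    rw [lineDerivOp_apply_eq_fderiv]
    change fderiv ℝ (fun y ↦ fderiv ℝ f y b) x a = _
    have h : DifferentiableAt ℝ (fderiv ℝ f) x := (fderivCLM ℝ E F f).differentiableAt
    simp [fderiv_clm_apply h (differentiableAt_const b)]
  ext x
  rw [key, key]
  have h : ContDiffAt ℝ 2 f x := (f.smooth 2).contDiffAt
  exact (h.isSymmSndFDerivAt (by simp)).eq v w

/-- Multiplication of a Schwartz function by a continuous linear functional. -/
noncomputable abbrev mulLinear (L : E →L[ℝ] ℝ) : 𝓢(E, F) →L[ℝ] 𝓢(E, F) := smulLeftCLM F L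

theorem mulLinear_apply (L : E →L[ℝ] ℝ) (f : 𝓢(E, F)) (x : E) :
    mulLinear L f x = L x • f x :=
  smulLeftCLM_apply_apply L.hasTemperateGrowth f x

theorem lineDerivOp_mulLinear (L : E →L[ℝ] ℝ) (v : E) (f : 𝓢(E, F)) :
    ∂_{v} (mulLinear L f) = L v • f + mulLinear L (∂_{v} f) := by
  ext x
  have h : (mulLinear L f : E → F) = fun y ↦ L y • f y := funext (mulLinear_apply L f)
  rw [lineDerivOp_apply_eq_fderiv, h, fderiv_fun_smul L.differentiableAt f.differentiableAt]
  simp [mulLinear_apply, lineDerivOp_apply_eq_fderiv, add_comm]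

variable [FiniteDimensional ℝ E] [MeasurableSpace E] [BorelSpace E]
  (μ : Measure E) [μ.IsAddHaarMeasure]

theorem integrable_inner (f g : 𝓢(E, F)) : Integrable (fun x ↦ inner ℝ (f x) (g x)) μ :=
  (pairing (innerSL ℝ) f g).integrable

/-- The real `L²` inner product of two Schwartz functions, as a bilinear form. -/
noncomputable def innerForm : 𝓢(E, F) →ₗ[ℝ] 𝓢(E, F) →ₗ[ℝ] ℝ :=
  LinearMap.mk₂ ℝ (fun f g ↦ ∫ x, inner ℝ (f x) (g x) ∂μ)
    (fun f₁ f₂ g ↦ by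
      simpa [inner_add_left] using
        integral_add (integrable_inner μ f₁ g) (integrable_inner μ f₂ g))
    (fun c f g ↦ by simp [real_inner_smul_left, integral_const_mul])
    (fun f g₁ g₂ ↦ by
      simpa [inner_add_right] using
        integral_add (integrable_inner μ f g₁) (integrable_inner μ f g₂))
    (fun c f g ↦ by simp [real_inner_smul_right, integral_const_mul])

theorem innerForm_apply (f g : 𝓢(E, F)) :
    innerForm μ f g = ∫ x, inner ℝ (f x) (g x) ∂μ := rfl

theorem innerForm_self (f : 𝓢(E, F)) : innerForm μ f f = ∫ x, ‖f x‖ ^ 2 ∂μ := by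
  simp [innerForm_apply]

theorem innerForm_comm (f g : 𝓢(E, F)) : innerForm μ f g = innerForm μ g f := by
  simp only [innerForm_apply, real_inner_comm]

theorem innerForm_lineDerivOp_right (v : E) (f g : 𝓢(E, F)) :
    innerForm μ f (∂_{v} g) = -innerForm μ (∂_{v} f) g :=
  integral_bilinear_lineDerivOp_right_eq_neg_left f g (innerSL ℝ) v

theorem innerForm_mulLinear_right (L : E →L[ℝ] ℝ) (f g : 𝓢(E, F)) :
    innerForm μ f (mulLinear L g) = innerForm μ (mulLinear L f) g := by
  simp only [innerForm_apply, mulLinear_apply, real_inner_smul_left, real_inner_smul_right]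

theorem innerForm_mulLinear_lineDerivOp (L : E →L[ℝ] ℝ) (v : E) (f : 𝓢(E, F)) :
    innerForm μ f (mulLinear L (∂_{v} f)) = -(L v * innerForm μ f f) / 2 := by
  have h : innerForm μ f (mulLinear L (∂_{v} f)) =
      -(L v * innerForm μ f f + innerForm μ f (mulLinear L (∂_{v} f))) := by
    conv_lhs => rw [innerForm_mulLinear_right, innerForm_lineDerivOp_right, lineDerivOp_mulLinear]
    rw [innerForm_comm μ f (mulLinear L _)]
    simp
  linarith

theorem innerForm_lineDerivOp_twice (v : E) (f g : 𝓢(E, F)) :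
    innerForm μ (∂_{v} (∂_{v} f)) g = innerForm μ f (∂_{v} (∂_{v} g)) := by
  simp [innerForm_lineDerivOp_right]

/-- Testing `‖f‖ ^ (p - 2) • f` against `L • ∂_{v} f`. -/
theorem innerForm_norm_rpow_mulLinear_lineDerivOp {p : ℝ} (hp : 1 < p) (L : E →L[ℝ] ℝ) (v : E)
    (f N : 𝓢(E, F)) (hN : ∀ x, N x = ‖f x‖ ^ (p - 2) • f x) :
    innerForm μ N (mulLinear L (∂_{v} f)) = -(L v * innerForm μ N f) / p := by
  have hpow (x : E) : inner ℝ (N x) (f x) = ‖f x‖ ^ p :=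
    inner_norm_rpow_smul_self (by linarith) _ _ (hN x)
  have hderiv (x : E) :
      L x * fderiv ℝ (fun y ↦ ‖f y‖ ^ p) x v =
        p * inner ℝ (N x) (mulLinear L (∂_{v} f) x) := by
    rw [f.differentiable.fderiv_norm_rpow hp, hN, mulLinear_apply, lineDerivOp_apply_eq_fderiv]
    simp [real_inner_smul_left, real_inner_smul_right]
    ring
  have hdiff : Differentiable ℝ (fun y ↦ ‖f y‖ ^ p) := f.differentiable.norm_rpow hp
  have h := integral_mul_fderiv_eq_neg_fderiv_mul_of_integrable (μ := μ) (v := v)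
    (f := fun x ↦ L x) (g := fun y ↦ ‖f y‖ ^ p)
    (by simpa [← hpow] using (integrable_inner μ N f).const_mul (L v))
    (by simpa only [hderiv] using (integrable_inner μ N (mulLinear L (∂_{v} f))).const_mul p)
    (by
      simpa [← hpow, mulLinear_apply, real_inner_smul_right] using
        integrable_inner μ N (mulLinear L f))
    (fun x _ ↦ L.differentiableAt) (fun x _ ↦ hdiff x)
  simp only [hderiv, integral_const_mul, ContinuousLinearMap.fderiv] at h
  simp only [innerForm_apply, hpow]
  field_simp
  linarith

end SchwartzMap

theorem pdx_schwartzMap (u : 𝓢(ℝ × ℝ, ℂ)) : pdx u = ∂_{((1 : ℝ), (0 : ℝ))} u := by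
  ext z
  have h : HasDerivAt (fun x : ℝ ↦ (x, z.2)) ((1 : ℝ), (0 : ℝ)) z.1 :=
    (hasDerivAt_id z.1).prodMk (hasDerivAt_const z.1 z.2)
  exact ((u.hasFDerivAt z).comp_hasDerivAt z.1 h).deriv

theorem pdy_schwartzMap (u : 𝓢(ℝ × ℝ, ℂ)) : pdy u = ∂_{((0 : ℝ), (1 : ℝ))} u := by
  ext z
  have h : HasDerivAt (fun y : ℝ ↦ (z.1, y)) ((0 : ℝ), (1 : ℝ)) z.2 :=
    (hasDerivAt_const z.2 z.1).prodMk (hasDerivAt_id z.2)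
  exact ((u.hasFDerivAt z).comp_hasDerivAt z.2 h).deriv

open SchwartzMap

/-- Pohozaev identity for standing waves. -/
theorem stmt_4 (p ω : ℝ) (hp : 2 < p) (u : SchwartzMap (ℝ × ℝ) ℂ)
    (hu : IsStandingWave p ω (fun z => u z)) :
    Xf (fun z => u z) + Yf (fun z => u z) = (3 * (p - 2) / (4 * p)) * Pf p (fun z => u z) := by
  set e₁ : ℝ × ℝ := (1, 0)
  set e₂ : ℝ × ℝ := (0, 1)
  set x : ℝ × ℝ →L[ℝ] ℝ := ContinuousLinearMap.fst ℝ ℝ ℝ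
  set y : ℝ × ℝ →L[ℝ] ℝ := ContinuousLinearMap.snd ℝ ℝ ℝ
  have hx₁ : x e₁ = 1 := rfl
  have hx₂ : x e₂ = 0 := rfl
  have hy₁ : y e₁ = 0 := rfl
  have hy₂ : y e₂ = 1 := rfl
  set N : 𝓢(ℝ × ℝ, ℂ) := -∂_{e₁} (∂_{e₁} u) + ∂_{e₂} (∂_{e₂} (∂_{e₂} (∂_{e₂} u))) + ω • u with hNdef
  have hN (z : ℝ × ℝ) : N z = ‖u z‖ ^ (p - 2) • u z := by
    have h := hu z
    simp only [pdxx, pdyyyy, pdx_schwartzMap, pdy_schwartzMap] at h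
    simpa [hNdef] using h
  set B := innerForm (F := ℂ) (volume : Measure (ℝ × ℝ))
  have hX : Xf u = B (∂_{e₁} u) (∂_{e₁} u) := by
    simp [B, innerForm_self, Xf, pdx_schwartzMap, e₁]
  have hY : Yf u = B (∂_{e₂} (∂_{e₂} u)) (∂_{e₂} (∂_{e₂} u)) := by
    simp [B, innerForm_self, Yf, pdyy, pdy_schwartzMap, e₂]
  have hP : Pf p u = B N u := by
    simp only [B, innerForm_apply, Pf]
    congr with z
    exact (inner_norm_rpow_smul_self (by linarith) _ _ (hN z)).symm
  have hNB (g : 𝓢(ℝ × ℝ, ℂ)) : B N g =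
      -B (∂_{e₁} (∂_{e₁} u)) g + B (∂_{e₂} (∂_{e₂} u)) (∂_{e₂} (∂_{e₂} g)) + ω * B u g := by
    rw [← innerForm_lineDerivOp_twice]
    simp [hNdef, B]
  have hmul : B N u = Xf u + Yf u + ω * B u u := by
    rw [hNB, hX, hY, innerForm_lineDerivOp_right volume e₁]
  have hdilx : B N (mulLinear x (∂_{e₁} u)) = -(B N u / p) := by
    rw [innerForm_norm_rpow_mulLinear_lineDerivOp volume (by linarith) x e₁ u N hN, hx₁, one_mul,
      neg_div]
  have hdily : B N (mulLinear y (∂_{e₂} u)) = -(B N u / p) := by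
    rw [innerForm_norm_rpow_mulLinear_lineDerivOp volume (by linarith) y e₂ u N hN, hy₂, one_mul,
      neg_div]
  have hx : B N (mulLinear x (∂_{e₁} u)) = Xf u / 2 - Yf u / 2 - ω * B u u / 2 := by
    have h₁ : B (∂_{e₁} (∂_{e₁} u)) (mulLinear x (∂_{e₁} u)) = -Xf u / 2 := by
      rw [innerForm_comm, ← innerForm_mulLinear_right, innerForm_mulLinear_lineDerivOp, hx₁, hX,
        one_mul]
    have h₂ : ∂_{e₂} (∂_{e₂} (mulLinear x (∂_{e₁} u))) =
        mulLinear x (∂_{e₁} (∂_{e₂} (∂_{e₂} u))) := by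
      simp only [lineDerivOp_mulLinear, hx₂, zero_smul, zero_add, lineDerivOp_comm e₂ e₁]
    rw [hNB, h₁, h₂, innerForm_mulLinear_lineDerivOp, innerForm_mulLinear_lineDerivOp, hx₁, ← hY]
    ring
  have hy : B N (mulLinear y (∂_{e₂} u)) = -Xf u / 2 + 3 * Yf u / 2 - ω * B u u / 2 := by
    have h₁ : B (∂_{e₁} (∂_{e₁} u)) (mulLinear y (∂_{e₂} u)) = Xf u / 2 := by
      have := innerForm_lineDerivOp_right volume e₁ (mulLinear y (∂_{e₂} u)) (∂_{e₁} u)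
      rw [innerForm_comm, this, lineDerivOp_mulLinear, hy₁, zero_smul, zero_add,
        lineDerivOp_comm e₁ e₂, innerForm_comm, innerForm_mulLinear_lineDerivOp, hy₂, hX]
      ring
    have h₂ : ∂_{e₂} (∂_{e₂} (mulLinear y (∂_{e₂} u))) =
        (2 : ℝ) • ∂_{e₂} (∂_{e₂} u) + mulLinear y (∂_{e₂} (∂_{e₂} (∂_{e₂} u))) := by
      simp only [lineDerivOp_mulLinear, LineDeriv.lineDerivOp_add, hy₂, one_smul, two_smul, add_assoc]
    rw [hNB, h₁, h₂, map_add, map_smul, innerForm_mulLinear_lineDerivOp,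
      innerForm_mulLinear_lineDerivOp, hy₂, ← hY, smul_eq_mul]
    ring
  change Xf u + Yf u = 3 * (p - 2) / (4 * p) * Pf p u
  have hXval : 2 * Xf u = B N u - 2 * (B N u / p) := by linarith
  have hYval : 4 * Yf u = B N u - 2 * (B N u / p) := by linarith
  have hp0 : p ≠ 0 := by linarith
  have hsum : Xf u + Yf u = 3 / 4 * (B N u - 2 * (B N u / p)) := by linarith
  rw [hsum, hP]
  field_simp
end

section
/- Let p > 2 and ω ∈ ℝ. If u is a standing-wave solution, then J_ω(u) = ((p−2)/(2p)) · P(u) = (2(p−2)ω/(p+6)) · M(u). -/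
open MeasureTheory

open LineDeriv SchwartzMap

section Schwartz

variable {E : Type*} [NormedAddCommGroup E] [NormedSpace ℝ E]

/-- Multiplication of a Schwartz function by a continuous linear functional. -/
noncomputable def weightMul (L : E →L[ℝ] ℝ) (f : SchwartzMap E ℂ) : SchwartzMap E ℂ :=
  smulLeftCLM ℂ (fun z => L z) f

theorem weightMul_apply (L : E →L[ℝ] ℝ) (f : SchwartzMap E ℂ) (z : E) :
    weightMul L f z = L z • f z :=
  smulLeftCLM_apply_apply (by fun_prop) f z

theorem lineDerivOp_weightMul (L : E →L[ℝ] ℝ) (v : E) (f : SchwartzMap E ℂ) :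
    ∂_{v} (weightMul L f) = L v • f + weightMul L (∂_{v} f) := by
  ext z
  have h : HasFDerivAt (weightMul L f) _ z :=
    (L.hasFDerivAt.smul (f.hasFDerivAt z)).congr_of_eventuallyEq
      (Filter.Eventually.of_forall (weightMul_apply L f))
  rw [lineDerivOp_apply_eq_fderiv, h.fderiv]
  simp [weightMul_apply, lineDerivOp_apply_eq_fderiv, add_comm]

theorem integral_inner_weightMul_comm [MeasurableSpace E] (μ : Measure E) (L : E →L[ℝ] ℝ)
    (f g : SchwartzMap E ℂ) :
    ∫ z, inner ℝ (f z) (weightMul L g z) ∂μ = ∫ z, inner ℝ (g z) (weightMul L f z) ∂μ := by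
  congr 1 with z
  rw [weightMul_apply, weightMul_apply, real_inner_smul_right, real_inner_smul_right,
    real_inner_comm]

variable [FiniteDimensional ℝ E] [MeasurableSpace E] [BorelSpace E]
  (μ : Measure E) [μ.IsAddHaarMeasure]

theorem integrable_inner_schwartz (f g : SchwartzMap E ℂ) :
    Integrable (fun z => inner ℝ (f z) (g z)) μ :=
  (pairing (innerSL ℝ) f g).integrable

theorem integral_inner_lineDerivOp (f g : SchwartzMap E ℂ) (v : E) :
    ∫ z, inner ℝ ((∂_{v} f) z) (g z) ∂μ = -∫ z, inner ℝ (f z) ((∂_{v} g) z) ∂μ := by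
  have h := integral_bilinear_lineDerivOp_right_eq_neg_left (μ := μ) f g (innerSL ℝ) v
  change ∫ z, inner ℝ (f z) ((∂_{v} g) z) ∂μ = -∫ z, inner ℝ ((∂_{v} f) z) (g z) ∂μ at h
  linarith

theorem integral_inner_lineDerivOp_lineDerivOp (f g : SchwartzMap E ℂ) (v : E) :
    ∫ z, inner ℝ ((∂_{v} (∂_{v} f)) z) (g z) ∂μ =
      ∫ z, inner ℝ (f z) ((∂_{v} (∂_{v} g)) z) ∂μ := by
  rw [integral_inner_lineDerivOp, integral_inner_lineDerivOp, neg_neg]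

theorem integral_inner_weightMul_lineDerivOp_self (L : E →L[ℝ] ℝ) (f : SchwartzMap E ℂ) (v : E) :
    ∫ z, inner ℝ (f z) (weightMul L (∂_{v} f) z) ∂μ = -(L v / 2) * ∫ z, ‖f z‖ ^ 2 ∂μ := by
  have h := integral_inner_lineDerivOp μ f (weightMul L f) v
  have hadd : ∫ z, inner ℝ (f z) ((∂_{v} (weightMul L f)) z) ∂μ =
      L v * (∫ z, ‖f z‖ ^ 2 ∂μ) + ∫ z, inner ℝ (f z) (weightMul L (∂_{v} f) z) ∂μ := by
    rw [← integral_const_mul, ← integral_add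
      (by simpa only [real_inner_self_eq_norm_sq] using
        (integrable_inner_schwartz μ f f).const_mul (L v))
      (integrable_inner_schwartz μ _ _), lineDerivOp_weightMul]
    congr 1 with z
    rw [add_apply, smul_apply, inner_add_right, real_inner_smul_right,
      real_inner_self_eq_norm_sq]
  rw [integral_inner_weightMul_comm, hadd] at h
  linarith

theorem integrable_norm_rpow_mul_inner {q : ℝ} (hq : 0 ≤ q) (u f g : SchwartzMap E ℂ) :
    Integrable (fun z => ‖u z‖ ^ q * inner ℝ (f z) (g z)) μ := by
  refine (integrable_inner_schwartz μ f g).bdd_mul (c := ‖u.toBoundedContinuousFunction‖ ^ q)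
    (u.continuous.norm.rpow_const fun _ => Or.inr hq).aestronglyMeasurable
    (Filter.Eventually.of_forall fun z => ?_)
  rw [Real.norm_of_nonneg (by positivity)]
  exact Real.rpow_le_rpow (norm_nonneg _)
    (u.toBoundedContinuousFunction.norm_coe_le_norm z) hq

theorem norm_rpow_eq_mul_inner {p : ℝ} (hp : 2 < p) (w : ℂ) :
    ‖w‖ ^ p = ‖w‖ ^ (p - 2) * inner ℝ w w := by
  rw [real_inner_self_eq_norm_sq, ← Real.rpow_two, ← Real.rpow_add_of_nonneg] <;>
    first | positivity | linarith | ring_nf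

theorem integral_norm_rpow_mul_inner_weightMul_lineDerivOp {p : ℝ} (hp : 2 < p)
    (L : E →L[ℝ] ℝ) (u : SchwartzMap E ℂ) (v : E) :
    ∫ z, ‖u z‖ ^ (p - 2) * inner ℝ (u z) (weightMul L (∂_{v} u) z) ∂μ =
      -(L v / p) * ∫ z, ‖u z‖ ^ p ∂μ := by
  have hp0 : p ≠ 0 := by linarith
  have hq : 0 ≤ p - 2 := by linarith
  have hd (z : E) : fderiv ℝ (fun z => ‖u z‖ ^ p) z v =
      p * ‖u z‖ ^ (p - 2) * inner ℝ (u z) ((∂_{v} u) z) := by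
    rw [u.differentiable.fderiv_norm_rpow (by linarith)]
    simp [lineDerivOp_apply_eq_fderiv]
  have h := integral_mul_fderiv_eq_neg_fderiv_mul_of_integrable (μ := μ) (v := v)
    (f := fun z => L z) (g := fun z => ‖u z‖ ^ p)
    (by
      simp only [L.fderiv, norm_rpow_eq_mul_inner hp]
      exact (integrable_norm_rpow_mul_inner μ hq u u u).const_mul _)
    (by
      refine ((integrable_norm_rpow_mul_inner μ hq u u (weightMul L (∂_{v} u))).const_mul
        p).congr (Filter.Eventually.of_forall fun z => ?_)
      simp only [hd, weightMul_apply, real_inner_smul_right]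
      ring)
    (by
      refine (integrable_norm_rpow_mul_inner μ hq u u (weightMul L u)).congr
        (Filter.Eventually.of_forall fun z => ?_)
      simp only [norm_rpow_eq_mul_inner hp, weightMul_apply, real_inner_smul_right]
      ring)
    (fun z _ => L.differentiableAt)
    (fun z _ => ((hasFDerivAt_norm_rpow (u z) (by linarith)).comp z
      (u.hasFDerivAt z)).differentiableAt)
  simp only [L.fderiv, hd, integral_const_mul] at h
  have e : ∫ z, L z * (p * ‖u z‖ ^ (p - 2) * inner ℝ (u z) ((∂_{v} u) z)) ∂μ =
      p * ∫ z, ‖u z‖ ^ (p - 2) * inner ℝ (u z) (weightMul L (∂_{v} u) z) ∂μ := by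
    rw [← integral_const_mul]
    congr 1 with z
    rw [weightMul_apply, real_inner_smul_right]
    ring
  rw [e] at h
  field_simp
  linarith

end Schwartz

theorem pdx_schwartz (f : SchwartzMap (ℝ × ℝ) ℂ) :
    pdx (fun z => f z) = fun z => (∂_{((1, 0) : ℝ × ℝ)} f) z := by
  ext z
  have h : HasDerivAt (fun x : ℝ => (x, z.2)) ((1, 0) : ℝ × ℝ) z.1 :=
    (hasDerivAt_id z.1).prodMk (hasDerivAt_const z.1 z.2)
  exact ((f.hasFDerivAt z).comp_hasDerivAt z.1 h).deriv

theorem pdy_schwartz (f : SchwartzMap (ℝ × ℝ) ℂ) :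
    pdy (fun z => f z) = fun z => (∂_{((0, 1) : ℝ × ℝ)} f) z := by
  ext z
  have h : HasDerivAt (fun y : ℝ => (z.1, y)) ((0, 1) : ℝ × ℝ) z.2 :=
    (hasDerivAt_const z.2 z.1).prodMk (hasDerivAt_id z.2)
  exact ((f.hasFDerivAt z).comp_hasDerivAt z.2 h).deriv

theorem lineDerivOp_lineDerivOp_comm {E : Type*} [NormedAddCommGroup E] [NormedSpace ℝ E]
    (f : SchwartzMap E ℂ) (v w : E) : ∂_{v} (∂_{w} f) = ∂_{w} (∂_{v} f) := by
  ext z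
  have hd : HasFDerivAt (fderiv ℝ f) (fderiv ℝ (fderivCLM ℝ E ℂ f) z) z :=
    (fderivCLM ℝ E ℂ f).hasFDerivAt z
  have key (a b : E) : (∂_{a} (∂_{b} f)) z = fderiv ℝ (fderivCLM ℝ E ℂ f) z a b := by
    have h : HasFDerivAt (∂_{b} f : SchwartzMap E ℂ) _ z :=
      hd.clm_apply (hasFDerivAt_const b z)
    rw [lineDerivOp_apply_eq_fderiv, h.fderiv]
    simp
  rw [key, key]
  exact second_derivative_symmetric f.hasFDerivAt hd v w

/-- The standing-wave equation tested against a Schwartz function. -/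
theorem IsStandingWave.integral_inner {p ω : ℝ} {u : SchwartzMap (ℝ × ℝ) ℂ}
    (hu : IsStandingWave p ω (fun z => u z)) (g : SchwartzMap (ℝ × ℝ) ℂ) :
    -(∫ z, inner ℝ ((∂_{((1, 0) : ℝ × ℝ)} (∂_{((1, 0) : ℝ × ℝ)} u)) z) (g z))
      + (∫ z, inner ℝ ((∂_{((0, 1) : ℝ × ℝ)} (∂_{((0, 1) : ℝ × ℝ)}
          (∂_{((0, 1) : ℝ × ℝ)} (∂_{((0, 1) : ℝ × ℝ)} u)))) z) (g z))
      + ω * (∫ z, inner ℝ (u z) (g z))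
      = ∫ z, ‖u z‖ ^ (p - 2) * inner ℝ (u z) (g z) := by
  rw [← integral_neg, ← integral_const_mul, ← integral_add, ← integral_add]
  · congr 1 with z
    have h := hu z
    simp only [pdxx, pdyyyy, pdx_schwartz, pdy_schwartz, ← Complex.real_smul] at h
    rw [← real_inner_smul_left, ← real_inner_smul_left, ← inner_neg_left, ← inner_add_left,
      ← inner_add_left, h]
  · exact (integrable_inner_schwartz _ _ _).neg.add (integrable_inner_schwartz _ _ _)
  · exact (integrable_inner_schwartz _ _ _).const_mul _
  · exact (integrable_inner_schwartz _ _ _).neg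
  · exact integrable_inner_schwartz _ _ _

section Identities

variable {p ω : ℝ} {u : SchwartzMap (ℝ × ℝ) ℂ}

theorem Xf_schwartz (u : SchwartzMap (ℝ × ℝ) ℂ) :
    Xf (fun z => u z) = ∫ z, ‖(∂_{((1, 0) : ℝ × ℝ)} u) z‖ ^ 2 := by
  simp only [Xf, pdx_schwartz]

theorem Yf_schwartz (u : SchwartzMap (ℝ × ℝ) ℂ) :
    Yf (fun z => u z) = ∫ z, ‖(∂_{((0, 1) : ℝ × ℝ)} (∂_{((0, 1) : ℝ × ℝ)} u)) z‖ ^ 2 := by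
  simp only [Yf, pdyy, pdy_schwartz]

theorem IsStandingWave.nehari (hp : 2 < p) (hu : IsStandingWave p ω (fun z => u z)) :
    Xf (fun z => u z) + Yf (fun z => u z) + ω * Mf (fun z => u z) = Pf p (fun z => u z) := by
  have h := hu.integral_inner u
  simp only [← norm_rpow_eq_mul_inner hp] at h
  rw [integral_inner_lineDerivOp,
    integral_inner_lineDerivOp_lineDerivOp _ (∂_{((0, 1) : ℝ × ℝ)} (∂_{((0, 1) : ℝ × ℝ)} u))] at h
  simp only [real_inner_self_eq_norm_sq, neg_neg] at h
  rw [Xf_schwartz, Yf_schwartz]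
  exact h

theorem IsStandingWave.pohozaev_fst (hp : 2 < p) (hu : IsStandingWave p ω (fun z => u z)) :
    Xf (fun z => u z) / 2 - Yf (fun z => u z) / 2 - ω / 2 * Mf (fun z => u z) =
      -(Pf p (fun z => u z) / p) := by
  let L := ContinuousLinearMap.fst ℝ ℝ ℝ
  let x : ℝ × ℝ := (1, 0)
  let y : ℝ × ℝ := (0, 1)
  have hLx : L x = 1 := rfl
  have hLy : L y = 0 := rfl
  have h := hu.integral_inner (weightMul L (∂_{x} u))
  have hc : ∂_{y} (∂_{y} (weightMul L (∂_{x} u))) = weightMul L (∂_{x} (∂_{y} (∂_{y} u))) := by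
    rw [lineDerivOp_weightMul, hLy, zero_smul, zero_add, lineDerivOp_weightMul, hLy, zero_smul,
      zero_add, lineDerivOp_lineDerivOp_comm u y x, lineDerivOp_lineDerivOp_comm _ y x]
  rw [integral_inner_lineDerivOp_lineDerivOp _ (∂_{y} (∂_{y} u)), hc,
    integral_inner_weightMul_comm _ _ (∂_{x} (∂_{x} u)),
    integral_inner_weightMul_lineDerivOp_self, integral_inner_weightMul_lineDerivOp_self,
    integral_inner_weightMul_lineDerivOp_self,
    integral_norm_rpow_mul_inner_weightMul_lineDerivOp _ hp, hLx] at h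
  rw [Xf_schwartz, Yf_schwartz]
  unfold Mf Pf
  linear_combination h

theorem IsStandingWave.pohozaev_snd (hp : 2 < p) (hu : IsStandingWave p ω (fun z => u z)) :
    -(Xf (fun z => u z) / 2) + 3 / 2 * Yf (fun z => u z) - ω / 2 * Mf (fun z => u z) =
      -(Pf p (fun z => u z) / p) := by
  let L := ContinuousLinearMap.snd ℝ ℝ ℝ
  let x : ℝ × ℝ := (1, 0)
  let y : ℝ × ℝ := (0, 1)
  have hLx : L x = 0 := rfl
  have hLy : L y = 1 := rfl
  have h := hu.integral_inner (weightMul L (∂_{y} u))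
  have hcx : ∂_{x} (weightMul L (∂_{y} u)) = weightMul L (∂_{y} (∂_{x} u)) := by
    rw [lineDerivOp_weightMul, hLx, zero_smul, zero_add, lineDerivOp_lineDerivOp_comm]
  have hcy : ∂_{y} (∂_{y} (weightMul L (∂_{y} u))) =
      (2 : ℝ) • ∂_{y} (∂_{y} u) + weightMul L (∂_{y} (∂_{y} (∂_{y} u))) := by
    rw [lineDerivOp_weightMul, hLy, one_smul, lineDerivOp_add, lineDerivOp_weightMul, hLy,
      one_smul, two_smul, add_assoc]
  have hY : ∫ z, inner ℝ ((∂_{y} (∂_{y} u)) z) ((∂_{y} (∂_{y} (weightMul L (∂_{y} u)))) z) =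
      3 / 2 * ∫ z, ‖(∂_{y} (∂_{y} u)) z‖ ^ 2 := by
    simp only [hcy, add_apply, smul_apply, inner_add_right, real_inner_smul_right]
    rw [integral_add ((integrable_inner_schwartz _ _ _).const_mul _)
      (integrable_inner_schwartz _ _ _), integral_const_mul,
      integral_inner_weightMul_lineDerivOp_self, hLy]
    simp only [real_inner_self_eq_norm_sq]
    ring
  rw [integral_inner_lineDerivOp_lineDerivOp _ (∂_{y} (∂_{y} u)), hY,
    integral_inner_lineDerivOp _ (∂_{x} u), hcx,
    integral_inner_weightMul_lineDerivOp_self, integral_inner_weightMul_lineDerivOp_self,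
    integral_norm_rpow_mul_inner_weightMul_lineDerivOp _ hp, hLy] at h
  rw [Xf_schwartz, Yf_schwartz]
  unfold Mf Pf
  linear_combination h

end Identities

/-- Values of the action on standing waves. -/
theorem stmt_7 (p ω : ℝ) (hp : 2 < p) (u : SchwartzMap (ℝ × ℝ) ℂ)
    (hu : IsStandingWave p ω (fun z => u z)) :
    Jf p ω (fun z => u z) = ((p - 2) / (2 * p)) * Pf p (fun z => u z)
      ∧ Jf p ω (fun z => u z) = (2 * (p - 2) * ω / (p + 6)) * Mf (fun z => u z) := by
  have h₀ := hu.nehari hp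
  have h₁ := hu.pohozaev_fst hp
  have h₂ := hu.pohozaev_snd hp
  have hp0 : p ≠ 0 := by linarith
  have hp6 : p + 6 ≠ 0 := by linarith
  unfold Jf
  generalize Xf (fun z => u z) = X at *
  generalize Yf (fun z => u z) = Y at *
  generalize Mf (fun z => u z) = M at *
  generalize hQ : Pf p (fun z => u z) / p = Q at *
  have hP : Pf p (fun z => u z) = p * Q := by rw [← hQ]; field_simp
  rw [hP] at h₀ ⊢
  have hM : (p + 6) * Q = 4 * ω * M := by linarith
  constructor
  · field_simp
    linear_combination h₀
  · field_simp
    linear_combination (p + 6) * h₀ + (p - 2) * hM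
end
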